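/- arXiv:1103.5030 — 2 statements merged into one kernel-verified Lean document; each statement's English description precedes it below -/
import Mathlib

section
/- For every integer k ≥ 1, ∫_ℝ |1̂_{[0,1]}(β)|² · (∫_0^1 e^{2πi x^k β} dx) dβ = k/(k+1). -/
open Real MeasureTheory

namespace S12

open FourierTransform

noncomputable def A (β : ℝ) : ℂ := ∫ y in (0:ℝ)..1, Complex.exp (-2 * Real.pi * Complex.I * y * β)

noncomputable def tent (t : ℝ) : ℂ := ((max 0 (1 - |t|) : ℝ) : ℂ)

lemma tent_cont : Continuous tent := by
  unfold tent; fun_prop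

lemma tent_zero {t : ℝ} (h : t ∉ Set.Ioc (-1:ℝ) 1) : tent t = 0 := by
  have : 1 ≤ |t| := by
    by_contra hc
    push Not at hc
    rw [abs_lt] at hc
    exact h ⟨hc.1, hc.2.le⟩
  simp [tent, this]

lemma tent_int : Integrable tent := by
  have h := (tent_cont.integrableOn_Icc (a := -1) (b := 1) (μ := volume))
  refine (integrableOn_iff_integrable_of_support_subset ?_).1 h
  intro t ht
  by_contra hc
  exact ht (tent_zero fun hh => hc ⟨hh.1.le, hh.2⟩)

lemma A_cont : Continuous A := by
  unfold A
  apply intervalIntegral.continuous_parametric_intervalIntegral_of_continuous'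
  fun_prop

lemma A_eq {β : ℝ} (hβ : β ≠ 0) : A β =
    (Complex.exp (-2 * Real.pi * Complex.I * β) - 1) / (-2 * Real.pi * Complex.I * β) := by
  have hc : (-2 * Real.pi * Complex.I * β : ℂ) ≠ 0 := by
    simp [hβ, Real.pi_ne_zero]
  have := integral_exp_mul_complex (a := 0) (b := 1) hc
  simp only [Complex.ofReal_one, mul_one, Complex.ofReal_zero, mul_zero, Complex.exp_zero] at this
  rw [← this, A]
  congr 1; ext y; congr 1; ring

lemma normsq {β : ℝ} (hβ : β ≠ 0) : ((‖A β‖ : ℂ)) ^ 2 =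
    (Complex.exp (-2 * Real.pi * Complex.I * β) + Complex.exp (-(-2 * Real.pi * Complex.I * β)) - 2)
      / (-2 * Real.pi * Complex.I * β) ^ 2 := by
  have hc : (-2 * Real.pi * Complex.I * β : ℂ) ≠ 0 := by
    simp [hβ, Real.pi_ne_zero]
  have hconj : (starRingEnd ℂ) (-2 * Real.pi * Complex.I * β : ℂ) = -(-2 * Real.pi * Complex.I * β) := by
    simp
    exact Or.inl (map_ofNat _ 2)
  rw [← Complex.mul_conj', A_eq hβ]
  rw [map_div₀, map_sub, ← Complex.exp_conj, hconj, map_one]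
  generalize (-2 * Real.pi * Complex.I * β : ℂ) = c at *
  have h1 : Complex.exp c * Complex.exp (-c) = 1 := by rw [← Complex.exp_add]; simp
  field_simp
  linear_combination -h1

lemma int1 {c : ℂ} (hc : c ≠ 0) : ∫ t in (0:ℝ)..1, (1 - (t:ℂ)) * Complex.exp (c * t) =
    Complex.exp c / c ^ 2 - 1 / c - 1 / c ^ 2 := by
  have h : ∀ t : ℝ, HasDerivAt (fun t : ℝ => (1 - (t:ℂ)) * Complex.exp (c * t) / c
      + Complex.exp (c * t) / c ^ 2) ((1 - (t:ℂ)) * Complex.exp (c * t)) t := by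
    intro t
    have h0 : HasDerivAt (fun t : ℝ => (t:ℂ)) 1 t := Complex.ofRealCLM.hasDerivAt
    have he : HasDerivAt (fun t : ℝ => Complex.exp (c * t)) (Complex.exp (c * t) * (c * 1)) t :=
      (h0.const_mul c).cexp
    refine ((((h0.const_sub 1).mul he).div_const c).add (he.div_const (c ^ 2))).congr_deriv ?_
    field_simp
    ring
  rw [intervalIntegral.integral_eq_sub_of_hasDerivAt (fun t _ => h t)
    (Continuous.intervalIntegrable (by fun_prop) _ _)]
  simp
  ring

lemma int2 {c : ℂ} (hc : c ≠ 0) : ∫ t in (-1:ℝ)..0, (1 + (t:ℂ)) * Complex.exp (c * t) =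
    Complex.exp (-c) / c ^ 2 + 1 / c - 1 / c ^ 2 := by
  have := int1 (neg_ne_zero.2 hc)
  have h2 := intervalIntegral.integral_comp_neg (a := 0) (b := 1)
    (fun t : ℝ => (1 + (t:ℂ)) * Complex.exp (c * t))
  simp only [neg_zero] at h2
  rw [← h2]
  rw [show (-c) ^ 2 = c ^ 2 by ring] at this
  rw [div_neg, sub_neg_eq_add] at this
  rw [← this]
  congr 1; ext t; push_cast; ring_nf

lemma fourier_tent {β : ℝ} (hβ : β ≠ 0) : 𝓕 tent β = (‖A β‖ : ℂ) ^ 2 := by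
  have hc : (-2 * Real.pi * Complex.I * β : ℂ) ≠ 0 := by
    simp [hβ, Real.pi_ne_zero]
  rw [normsq hβ, Real.fourier_real_eq_integral_exp_smul]
  have e : ∀ t : ℝ, Complex.exp (↑(-2 * π * t * β) * Complex.I) • tent t =
      tent t * Complex.exp ((-2 * Real.pi * Complex.I * β) * t) := by
    intro t
    rw [smul_eq_mul, mul_comm]
    congr 2; push_cast; ring
  simp_rw [e]
  generalize (-2 * Real.pi * Complex.I * β : ℂ) = c at *
  have hcont : Continuous fun t : ℝ => tent t * Complex.exp (c * t) := by
    have := tent_cont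
    fun_prop
  rw [← setIntegral_eq_integral_of_forall_compl_eq_zero (s := Set.Ioc (-1:ℝ) 1)
    (fun t ht => by rw [tent_zero ht, zero_mul]),
    ← intervalIntegral.integral_of_le (by norm_num),
    ← intervalIntegral.integral_add_adjacent_intervals (b := 0)
      (hcont.intervalIntegrable _ _) (hcont.intervalIntegrable _ _)]
  have a1 : ∫ t in (0:ℝ)..1, tent t * Complex.exp (c * t) =
      ∫ t in (0:ℝ)..1, (1 - (t:ℂ)) * Complex.exp (c * t) := by
    apply intervalIntegral.integral_congr
    intro t ht
    rw [Set.uIcc_of_le (by norm_num)] at ht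
    have : max 0 (1 - |t|) = 1 - t := by
      rw [abs_of_nonneg ht.1, max_eq_right (by linarith [ht.2])]
    simp [tent, this]
  have a2 : ∫ t in (-1:ℝ)..0, tent t * Complex.exp (c * t) =
      ∫ t in (-1:ℝ)..0, (1 + (t:ℂ)) * Complex.exp (c * t) := by
    apply intervalIntegral.integral_congr
    intro t ht
    rw [Set.uIcc_of_le (by norm_num)] at ht
    have : max 0 (1 - |t|) = 1 + t := by
      rw [abs_of_nonpos ht.2, max_eq_right (by linarith [ht.1])]; ring
    simp [tent, this]
  rw [a1, a2, int1 hc, int2 hc]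
  ring

lemma fourier_ae : 𝓕 tent =ᵐ[volume] fun β => (‖A β‖ : ℂ) ^ 2 := by
  filter_upwards [compl_mem_ae_iff.2 (measure_singleton (μ := volume) (0:ℝ))] with β hβ
  exact fourier_tent hβ

lemma A_le_one (β : ℝ) : ‖A β‖ ≤ 1 := by
  have := intervalIntegral.norm_integral_le_of_norm_le_const (a := 0) (b := 1) (C := 1)
    (f := fun y : ℝ => Complex.exp (-2 * Real.pi * Complex.I * y * β)) (by
      intro y _
      rw [Complex.norm_exp]; simp)
  simpa [A] using this

lemma A_bound (β : ℝ) : ‖A β‖ ^ 2 ≤ 2 * (1 + β ^ 2)⁻¹ := by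
  have h1 : ‖A β‖ ^ 2 ≤ 1 := pow_le_one₀ (norm_nonneg _) (A_le_one β)
  have h2 : ‖A β‖ * |β| ≤ 1 := by
    rcases eq_or_ne β 0 with rfl | hβ
    · simp
    have hn : ‖Complex.exp (-2 * Real.pi * Complex.I * β)‖ = 1 := by
      rw [Complex.norm_exp]; simp
    have := norm_sub_le (Complex.exp (-2 * Real.pi * Complex.I * β)) 1
    rw [hn, norm_one] at this
    rw [A_eq hβ, norm_div]
    have hd : ‖(-2 * Real.pi * Complex.I * β : ℂ)‖ = 2 * π * |β| := by
      simp [abs_of_pos Real.pi_pos]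
    rw [hd]
    have hb : 0 < |β| := abs_pos.2 hβ
    have hp := Real.pi_gt_three
    rw [div_mul_eq_mul_div, div_le_one (by positivity)]
    nlinarith
  have h3 : ‖A β‖ ^ 2 * β ^ 2 ≤ 1 := by
    rw [← sq_abs β, ← mul_pow]
    exact pow_le_one₀ (by positivity) h2
  rw [← div_eq_mul_inv, le_div_iff₀ (by positivity)]
  linarith

lemma F_cont : Continuous fun β => (‖A β‖ : ℂ) ^ 2 := by
  have := A_cont
  fun_prop

lemma F_int : Integrable fun β => (‖A β‖ : ℂ) ^ 2 := by
  refine (integrable_inv_one_add_sq.const_mul 2).mono' F_cont.aestronglyMeasurable ?_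
  filter_upwards with β
  simpa using A_bound β

lemma inv_tent (t : ℝ) :
    ∫ β : ℝ, (‖A β‖ : ℂ) ^ 2 * Complex.exp (2 * Real.pi * Complex.I * t * β) = tent t := by
  have h := tent_cont.fourierInv_fourier_eq tent_int (F_int.congr fourier_ae.symm)
  rw [← congrFun h t, Real.fourierInv_eq']
  apply integral_congr_ae
  filter_upwards [fourier_ae] with β hβ
  rw [hβ, smul_eq_mul, mul_comm]
  congr 2
  simp
  ring

end S12

open S12 in
theorem stmt12 (k : ℕ) (hk : 1 ≤ k) :
    (∫ β : ℝ,
        (‖∫ y in (0:ℝ)..1, Complex.exp (-2 * Real.pi * Complex.I * y * β)‖ ^ 2 : ℂ) *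
          ∫ x in (0:ℝ)..1, Complex.exp (2 * Real.pi * Complex.I * (x : ℝ) ^ k * β))
      = (((k : ℝ) / (k + 1) : ℝ) : ℂ) := by
  change (∫ β : ℝ, (‖A β‖ : ℂ) ^ 2 *
    ∫ x in (0:ℝ)..1, Complex.exp (2 * Real.pi * Complex.I * (x : ℝ) ^ k * β)) = _
  simp_rw [← intervalIntegral.integral_const_mul,
    intervalIntegral.integral_of_le (zero_le_one (α := ℝ))]
  rw [integral_integral_swap]
  · rw [← intervalIntegral.integral_of_le (zero_le_one (α := ℝ))]
    have : ∀ x ∈ Set.uIcc (0:ℝ) 1, (∫ β : ℝ, (‖A β‖ : ℂ) ^ 2 *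
        Complex.exp (2 * Real.pi * Complex.I * (x : ℝ) ^ k * β)) = ((1 - x ^ k : ℝ) : ℂ) := by
      intro x hx
      rw [Set.uIcc_of_le (by norm_num)] at hx
      have h := inv_tent (x ^ k)
      rw [Complex.ofReal_pow] at h
      rw [h, tent, abs_of_nonneg (pow_nonneg hx.1 k),
        max_eq_right (by linarith [pow_le_one₀ hx.1 hx.2 (n := k)])]
    rw [intervalIntegral.integral_congr this, intervalIntegral.integral_ofReal]
    rw [intervalIntegral.integral_sub (by simp) (Continuous.intervalIntegrable (by fun_prop) _ _)]
    rw [integral_pow]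
    congr 1
    simp
    field_simp
    ring
  · have hF : Integrable (fun p : ℝ × ℝ => (‖A p.1‖ : ℂ) ^ 2)
        (volume.prod (volume.restrict (Set.Ioc (0:ℝ) 1))) := F_int.comp_fst _
    refine hF.mono ?_ ?_
    · have := A_cont
      apply Continuous.aestronglyMeasurable
      simp only [Function.uncurry_def]
      fun_prop
    · filter_upwards with p
      simp only [Function.uncurry_def]
      rw [norm_mul, Complex.norm_exp]
      have : (2 * Real.pi * Complex.I * (p.2 : ℂ) ^ k * p.1 : ℂ)
        = ((2 * π * p.2 ^ k * p.1 : ℝ) : ℂ) * Complex.I := by push_cast; ring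
      rw [this, Complex.re_ofReal_mul]
      simp
end

section
/- Let k ≥ 1, c_k > 0, let a₁, a₂ be integers with a₁ > 0, a₂ ≠ 0, and let B > 0. Then ∫_{|β| < log^B N / N} (∫_0^N e^{−2πi a₁ yβ} dy)(∫_0^N e^{−2πi a₂ zβ} dz)(∫_0^M e^{2πi c_k x^k β} dx) dβ = C_k(a₁,a₂) · c_k^{−1/k} · (k/(k+1)) · N^{(k+1)/k} + O(N^{(k+1)/k}/log^B N), where M = (max{a₁, a₁+a₂} · N / c_k)^{1/k} and the implied constant depends on k, c_k, a₁, a₂, and B. -/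
open Real Filter Asymptotics MeasureTheory

/-- The constant `C_k(a₁,a₂)`. -/
noncomputable def Ck (k : ℕ) (a₁ a₂ : ℤ) : ℝ :=
  if 0 < a₂ then
    (((a₁ : ℝ) + (a₂ : ℝ)) ^ ((1 : ℝ) / k) - (a₁ : ℝ) ^ ((1 : ℝ) / k)) / (a₂ : ℝ) +
      (((a₁ : ℝ) + (a₂ : ℝ)) ^ ((1 : ℝ) / k) - (a₂ : ℝ) ^ ((1 : ℝ) / k)) / (a₁ : ℝ)
  else if -a₁ ≤ a₂ then
    (((a₁ : ℝ) + (a₂ : ℝ)) ^ ((1 : ℝ) / k) - (a₁ : ℝ) ^ ((1 : ℝ) / k)) / (a₂ : ℝ) +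
      ((a₁ : ℝ) + (a₂ : ℝ)) ^ ((1 : ℝ) / k) / (a₁ : ℝ)
  else -(a₁ : ℝ) ^ ((1 : ℝ) / k) / (a₂ : ℝ)


lemma s15_bound (v t : ℝ) : ‖(1 - Real.cos (2*π*v*t))/t^2‖ ≤ (2*π^2*v^2+2) * (1+t^2)⁻¹ := by
  have h1 := Real.one_sub_sq_div_two_le_cos (x := 2*π*v*t)
  have h2 := Real.cos_le_one (2*π*v*t)
  have h3 := Real.neg_one_le_cos (2*π*v*t)
  rcases eq_or_ne t 0 with rfl | ht
  · simp; positivity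
  · have : 0 < t^2 := by positivity
    rw [Real.norm_of_nonneg (div_nonneg (by linarith) this.le), ← div_eq_mul_inv,
      div_le_div_iff₀ this (by positivity)]
    nlinarith

lemma s15_int (v : ℝ) : Integrable (fun t : ℝ => (1 - Real.cos (2*π*v*t))/t^2) := by
  refine Integrable.mono' (integrable_inv_one_add_sq.const_mul (2*π^2*v^2+2)) ?_
    (ae_of_all _ (fun t => s15_bound v t))
  apply Measurable.aestronglyMeasurable
  fun_prop

lemma s15_tentint (w : ℂ) (hw : w ≠ 0) : ∫ v in (-1:ℝ)..1, Complex.exp (w * v) * ((max (1 - |v|) 0 : ℝ) : ℂ)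
    = (Complex.exp w + Complex.exp (-w) - 2)/w^2 := by
  have hc : Continuous (fun v : ℝ => Complex.exp (w * v) * ((max (1 - |v|) 0 : ℝ) : ℂ)) := by fun_prop
  rw [← intervalIntegral.integral_add_adjacent_intervals (b := 0) (hc.intervalIntegrable _ _)
    (hc.intervalIntegrable _ _)]
  have e1 : ∫ v in (-1:ℝ)..0, Complex.exp (w * v) * ((max (1 - |v|) 0 : ℝ) : ℂ)
     = ∫ v in (-1:ℝ)..0, Complex.exp (w * v) * (1 + v) := by
    apply intervalIntegral.integral_congr
    intro v hv
    rw [Set.uIcc_of_le (by norm_num)] at hv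
    simp only
    rw [abs_of_nonpos hv.2, max_eq_left (by linarith [hv.1])]
    push_cast; ring
  have e2 : ∫ v in (0:ℝ)..1, Complex.exp (w * v) * ((max (1 - |v|) 0 : ℝ) : ℂ)
     = ∫ v in (0:ℝ)..1, Complex.exp (w * v) * (1 - v) := by
    apply intervalIntegral.integral_congr
    intro v hv
    rw [Set.uIcc_of_le (by norm_num)] at hv
    simp only
    rw [abs_of_nonneg hv.1, max_eq_left (by linarith [hv.2])]
    push_cast; ring
  have hd : ∀ v : ℝ, HasDerivAt (fun v : ℝ => (v:ℂ)) 1 v := fun v => Complex.ofRealCLM.hasDerivAt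
  have hE : ∀ v : ℝ, HasDerivAt (fun v : ℝ => Complex.exp (w * v)) (Complex.exp (w*v) * (w*1)) v :=
    fun v => ((hd v).const_mul w).cexp
  have f1 := intervalIntegral.integral_eq_sub_of_hasDerivAt (a := -1) (b := 0)
    (f := fun v : ℝ => Complex.exp (w * v) * ((1+v)/w - 1/w^2)) (f' := fun v : ℝ => Complex.exp (w * v) * (1 + v))
    (fun v _ => by
      refine ((hE v).mul ((((hd v).const_add 1).div_const w).sub_const (1/w^2))).congr_deriv ?_
      field_simp; ring) (Continuous.intervalIntegrable (by fun_prop) _ _)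
  have f2 := intervalIntegral.integral_eq_sub_of_hasDerivAt (a := 0) (b := 1)
    (f := fun v : ℝ => Complex.exp (w * v) * ((1-v)/w + 1/w^2)) (f' := fun v : ℝ => Complex.exp (w * v) * (1 - v))
    (fun v _ => by
      refine ((hE v).mul ((((hd v).const_sub 1).div_const w).add_const (1/w^2))).congr_deriv ?_
      field_simp; ring) (Continuous.intervalIntegrable (by fun_prop) _ _)
  rw [e1, e2, f1, f2]
  push_cast
  simp only [mul_zero, Complex.exp_zero, mul_one, mul_neg]
  field_simp; ring

lemma s15_fourier (w : ℝ) (hw : w ≠ 0) :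
    FourierTransform.fourier (fun v : ℝ => ((max (1 - |v|) 0 : ℝ) : ℂ)) w
      = (((1 - Real.cos (2*π*1*w))/w^2 / (2*π^2) : ℝ) : ℂ) := by
  rw [Real.fourier_real_eq_integral_exp_smul]
  have hs : ∀ v : ℝ, v ∉ Set.Ioc (-1:ℝ) 1 →
      Complex.exp (↑(-2 * π * v * w) * Complex.I) • ((max (1 - |v|) 0 : ℝ) : ℂ) = 0 := by
    intro v hv
    have : 1 ≤ |v| := by
      by_contra h
      push Not at h
      rw [abs_lt] at h
      exact hv ⟨h.1, h.2.le⟩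
    rw [max_eq_right (by linarith)]; simp
  rw [← setIntegral_eq_integral_of_forall_compl_eq_zero hs,
    ← intervalIntegral.integral_of_le (by norm_num)]
  have hw' : (-2 * π * w * Complex.I : ℂ) ≠ 0 := by
    simp [hw, Real.pi_ne_zero]
  have := s15_tentint _ hw'
  rw [show (∫ v in (-1:ℝ)..1, Complex.exp (↑(-2 * π * v * w) * Complex.I) • ((max (1 - |v|) 0 : ℝ) : ℂ))
     = (∫ v in (-1:ℝ)..1, Complex.exp ((-2 * π * w * Complex.I : ℂ) * v) * ((max (1 - |v|) 0 : ℝ) : ℂ)) from ?_, this]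
  · have h := Complex.two_cos (x := (2*π*w : ℂ))
    have e1 : (-2 * π * w * Complex.I : ℂ) = -(2*π*w) * Complex.I := by ring
    have e2 : -(-2 * π * w * Complex.I : ℂ) = (2*π*w) * Complex.I := by ring
    rw [e2, e1]
    have e3 : Complex.exp (-(2*π*w) * Complex.I) + Complex.exp ((2*π*w) * Complex.I) = 2 * Complex.cos (2*π*w) := by
      rw [h]; ring
    rw [e3, mul_pow, Complex.I_sq]
    push_cast
    have : (w:ℂ) ≠ 0 := by exact_mod_cast hw
    have : (π:ℂ) ≠ 0 := by exact_mod_cast Real.pi_ne_zero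
    field_simp; ring
  · apply intervalIntegral.integral_congr
    intro v _
    simp only [smul_eq_mul]
    congr 2
    push_cast; ring

lemma s15_K : ∫ t : ℝ, (1 - Real.cos (2*π*1*t))/t^2 = 2*π^2 := by
  set f : ℝ → ℂ := (fun v : ℝ => ((max (1 - |v|) 0 : ℝ) : ℂ)) with hf
  have hcont : Continuous f := by fun_prop
  have hcs : HasCompactSupport f := by
    apply HasCompactSupport.intro (isCompact_Icc (a := (-1:ℝ)) (b := 1))
    intro v hv
    have : 1 ≤ |v| := by
      by_contra h
      push Not at h
      rw [abs_lt] at h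
      exact hv ⟨h.1.le, h.2.le⟩
    simp only [hf]
    rw [max_eq_right (by linarith)]; simp
  have hae : ∀ᵐ w : ℝ, FourierTransform.fourier f w = (((1 - Real.cos (2*π*1*w))/w^2 / (2*π^2) : ℝ) : ℂ) := by
    filter_upwards [Measure.ae_ne volume (0:ℝ)] with w hw using s15_fourier w hw
  have hI : Integrable (FourierTransform.fourier f) :=
    (((s15_int 1).div_const (2*π^2)).ofReal (𝕜 := ℂ)).congr (by
      filter_upwards [hae] with w h using h.symm)
  have := congrFun (hcont.fourierInv_fourier_eq (hcont.integrable_of_hasCompactSupport hcs) hI) 0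
  rw [Real.fourierInv_eq] at this
  simp only [inner_zero_right, AddChar.map_zero_eq_one, one_smul] at this
  rw [integral_congr_ae hae, integral_complex_ofReal, integral_div] at this
  simp only [hf, abs_zero, sub_zero] at this
  rw [max_eq_left (by norm_num)] at this
  have h2 : (∫ t : ℝ, (1 - Real.cos (2*π*1*t))/t^2) / (2*π^2) = 1 := by exact_mod_cast this
  have : (2*π^2) ≠ 0 := by positivity
  exact (div_eq_one_iff_eq this).1 h2

lemma s15_phi (v : ℝ) : ∫ t : ℝ, (1 - Real.cos (2*π*v*t))/t^2 = 2*π^2*|v| := by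
  rcases eq_or_ne v 0 with rfl | hv
  · simp
  have h := Measure.integral_comp_mul_left (fun t : ℝ => (1 - Real.cos (2*π*1*t))/t^2) v
  rw [s15_K] at h
  have : ∀ t : ℝ, (1 - Real.cos (2*π*v*t))/t^2 = v^2 * ((1 - Real.cos (2*π*1*(v*t)))/(v*t)^2) := by
    intro t
    rw [show 2*π*1*(v*t) = 2*π*v*t by ring]
    rcases eq_or_ne t 0 with rfl | ht
    · simp
    field_simp
  simp_rw [this]
  rw [integral_const_mul, h, abs_inv, smul_eq_mul, ← sq_abs]
  have : |v| ≠ 0 := by simpa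
  field_simp

lemma s15_trunc (v d : ℝ) (hd : 0 < d) :
    abs ((∫ t in (-d)..d, (1 - Real.cos (2*π*v*t))/t^2) - 2*π^2*|v|) ≤ 4/d := by
  have hI := s15_int v
  have hnn : ∀ t : ℝ, 0 ≤ (1 - Real.cos (2*π*v*t))/t^2 := fun t =>
    div_nonneg (by linarith [Real.cos_le_one (2*π*v*t)]) (sq_nonneg _)
  have h1 := intervalIntegral.integral_Iic_add_Ioi (b := d) hI.integrableOn hI.integrableOn
  have h2 := intervalIntegral.integral_Iic_sub_Iic (a := -d) (b := d) hI.integrableOn hI.integrableOn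
  have h3 := integral_comp_neg_Ioi d (fun t : ℝ => (1 - Real.cos (2*π*v*t))/t^2)
  simp only [mul_neg, Real.cos_neg, even_two, Even.neg_pow] at h3
  rw [s15_phi] at h1
  have h4 : ∫ t in Set.Ioi d, (1 - Real.cos (2*π*v*t))/t^2 ≤ 2/d := by
    have h5 : ∫ t in Set.Ioi d, 2 * t^(-2:ℝ) = 2/d := by
      rw [integral_const_mul, integral_Ioi_rpow_of_lt (by norm_num) hd]
      norm_num
      rw [Real.rpow_neg_one]; rfl
    rw [← h5]
    apply setIntegral_mono_on hI.integrableOn ((integrableOn_Ioi_rpow_of_lt (by norm_num) hd).const_mul _) measurableSet_Ioi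
    intro t ht
    have ht' : 0 < t := hd.trans ht
    rw [Real.rpow_neg ht'.le, ← div_eq_mul_inv]
    norm_cast
    gcongr
    linarith [Real.neg_one_le_cos (2*π*v*t)]
  have h5 : 0 ≤ ∫ t in Set.Ioi d, (1 - Real.cos (2*π*v*t))/t^2 := setIntegral_nonneg measurableSet_Ioi (fun t _ => hnn t)
  have h6 : 4/d = 2/d+2/d := by ring
  rw [abs_le]
  constructor <;> linarith

lemma s15_cont (a n : ℝ) : Continuous (fun β : ℝ =>
    ∫ y in (0:ℝ)..n, Complex.exp (-2 * π * Complex.I * a * y * β)) := by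
  apply intervalIntegral.continuous_parametric_intervalIntegral_of_continuous (s := fun _ => n)
  · unfold Function.uncurry; fun_prop
  · fun_prop

lemma s15_closed (a n β : ℝ) (ha : a ≠ 0) (hβ : β ≠ 0) :
    ∫ y in (0:ℝ)..n, Complex.exp (-2 * π * Complex.I * a * y * β)
     = (1 - Complex.exp (-2 * π * Complex.I * a * n * β)) / (2 * π * Complex.I * a * β) := by
  have h := integral_exp_mul_complex (a := 0) (b := n) (c := -2 * π * Complex.I * a * β)
    (by simp [ha, hβ, Real.pi_ne_zero])
  rw [show (fun y : ℝ => Complex.exp (-2 * π * Complex.I * a * y * β)) =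
    (fun y : ℝ => Complex.exp (-2 * π * Complex.I * a * β * y)) by
      funext y; congr 1; ring, h]
  rw [show (-2 * π * Complex.I * a * β : ℂ) = -(2 * π * Complex.I * a * β) by ring, div_neg, ← neg_div]
  congr 1
  simp only [Complex.ofReal_zero, mul_zero, Complex.exp_zero]
  rw [show -(2 * π * Complex.I * a * β : ℂ) * n = -2 * π * Complex.I * a * n * β by ring]
  ring

/-- integrand -/
noncomputable def s15H (a b n u β : ℝ) : ℂ :=
  (∫ y in (0:ℝ)..n, Complex.exp (-2 * π * Complex.I * a * y * β)) *
  (∫ y in (0:ℝ)..n, Complex.exp (-2 * π * Complex.I * b * y * β)) *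
  Complex.exp (2 * π * Complex.I * u * β)

lemma s15_Hcont (a b n u : ℝ) : Continuous (s15H a b n u) := by
  unfold s15H
  exact ((s15_cont a n).mul (s15_cont b n)).mul (by fun_prop)

/-- kernel -/
noncomputable def s15T (w t : ℝ) : ℝ := (1 - Real.cos (2*π*w*t))/t^2

lemma s15_sym (a b n u β : ℝ) (ha : a ≠ 0) (hb : b ≠ 0) (hβ : β ≠ 0) :
    s15H a b n u β + s15H a b n u (-β) = (((1/(2*π^2*a*b)) *
      (s15T u β - s15T (u-a*n) β - s15T (u-b*n) β + s15T (u-(a+b)*n) β) : ℝ) : ℂ) := by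
  unfold s15H s15T
  rw [s15_closed a n β ha hβ, s15_closed b n β hb hβ, s15_closed a n (-β) ha (neg_ne_zero.2 hβ),
    s15_closed b n (-β) hb (neg_ne_zero.2 hβ)]
  push_cast
  unfold Complex.cos
  obtain ⟨X, hX⟩ : ∃ X, X = Complex.exp (2 * π * Complex.I * u * β) := ⟨_, rfl⟩
  obtain ⟨A, hA⟩ : ∃ X, X = Complex.exp (-2 * π * Complex.I * a * n * β) := ⟨_, rfl⟩
  obtain ⟨B, hB⟩ : ∃ X, X = Complex.exp (-2 * π * Complex.I * b * n * β) := ⟨_, rfl⟩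
  have X0 : X ≠ 0 := hX ▸ Complex.exp_ne_zero _
  have A0 : A ≠ 0 := hA ▸ Complex.exp_ne_zero _
  have B0 : B ≠ 0 := hB ▸ Complex.exp_ne_zero _
  have r1 : Complex.exp (2 * π * Complex.I * u * -β) = X⁻¹ := by
    rw [hX, ← Complex.exp_neg]; congr 1; ring
  have r2 : Complex.exp (-2 * π * Complex.I * a * n * -β) = A⁻¹ := by
    rw [hA, ← Complex.exp_neg]; congr 1; ring
  have r3 : Complex.exp (-2 * π * Complex.I * b * n * -β) = B⁻¹ := by
    rw [hB, ← Complex.exp_neg]; congr 1; ring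
  have c1 : Complex.exp (2 * π * u * β * Complex.I) = X := by
    rw [hX]; congr 1; ring
  have c2 : Complex.exp (-(2 * π * u * β) * Complex.I) = X⁻¹ := by
    rw [hX, ← Complex.exp_neg]; congr 1; ring
  have c3 : Complex.exp (2 * π * (u - a * n) * β * Complex.I) = X * A := by
    rw [hX, hA, ← Complex.exp_add]; congr 1; ring
  have c4 : Complex.exp (-(2 * π * (u - a * n) * β) * Complex.I) = (X * A)⁻¹ := by
    rw [hX, hA, ← Complex.exp_add, ← Complex.exp_neg]; congr 1; ring
  have c5 : Complex.exp (2 * π * (u - b * n) * β * Complex.I) = X * B := by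
    rw [hX, hB, ← Complex.exp_add]; congr 1; ring
  have c6 : Complex.exp (-(2 * π * (u - b * n) * β) * Complex.I) = (X * B)⁻¹ := by
    rw [hX, hB, ← Complex.exp_add, ← Complex.exp_neg]; congr 1; ring
  have c7 : Complex.exp (2 * π * (u - (a + b) * n) * β * Complex.I) = X * A * B := by
    rw [hX, hA, hB, ← Complex.exp_add, ← Complex.exp_add]; congr 1; ring
  have c8 : Complex.exp (-(2 * π * (u - (a + b) * n) * β) * Complex.I) = (X * A * B)⁻¹ := by
    rw [hX, hA, hB, ← Complex.exp_add, ← Complex.exp_add, ← Complex.exp_neg]; congr 1; ring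
  rw [r1, r2, r3, c1, c2, c3, c4, c5, c6, c7, c8, ← hX, ← hA, ← hB]
  have a0 : (a:ℂ) ≠ 0 := by exact_mod_cast ha
  have b0 : (b:ℂ) ≠ 0 := by exact_mod_cast hb
  have β0 : (β:ℂ) ≠ 0 := by exact_mod_cast hβ
  have p0 : (π:ℂ) ≠ 0 := by exact_mod_cast Real.pi_ne_zero
  have i0 := Complex.I_ne_zero
  field_simp
  rw [Complex.I_sq]
  ring

/-- density -/
noncomputable def s15h (a b n u : ℝ) : ℝ :=
  1/(2*a*b) * (|u| - |u-a*n| - |u-b*n| + |u-(a+b)*n|)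

lemma s15_inner (a b n u d : ℝ) (ha : a ≠ 0) (hb : b ≠ 0) (hd : 0 < d) :
    ‖(∫ β in (-d)..d, s15H a b n u β) - ((s15h a b n u : ℝ) : ℂ)‖ ≤ 4/(π^2*|a*b| * d) := by
  have hT : ∀ w, IntervalIntegrable (s15T w) volume (-d) d := fun w => (s15_int w).intervalIntegrable
  have hH := (s15_Hcont a b n u)
  have hH' : IntervalIntegrable (fun β => s15H a b n u (-β)) volume (-d) d :=
    (hH.comp continuous_neg).intervalIntegrable _ _
  have e1 : ∫ β in (-d)..d, s15H a b n u (-β) = ∫ β in (-d)..d, s15H a b n u β := by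
    rw [intervalIntegral.integral_comp_neg, neg_neg]
  have e2 : (∫ β in (-d)..d, (s15H a b n u β + s15H a b n u (-β))) =
    ∫ β in (-d)..d, (((1/(2*π^2*a*b)) *
      (s15T u β - s15T (u-a*n) β - s15T (u-b*n) β + s15T (u-(a+b)*n) β) : ℝ) : ℂ) := by
    apply intervalIntegral.integral_congr_ae
    filter_upwards [Measure.ae_ne volume (0:ℝ)] with β hβ _ using s15_sym a b n u β ha hb hβ
  rw [intervalIntegral.integral_add (hH.intervalIntegrable _ _)
    hH', e1, intervalIntegral.integral_ofReal,
    intervalIntegral.integral_const_mul,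
    intervalIntegral.integral_add (((hT _).sub (hT _)).sub (hT _)) (hT _),
    intervalIntegral.integral_sub ((hT _).sub (hT _)) (hT _),
    intervalIntegral.integral_sub (hT _) (hT _)] at e2
  have t1 := s15_trunc u d hd
  have t2 := s15_trunc (u-a*n) d hd
  have t3 := s15_trunc (u-b*n) d hd
  have t4 := s15_trunc (u-(a+b)*n) d hd
  simp only [← s15T.eq_def] at t1 t2 t3 t4
  have e3 : (∫ β in (-d)..d, s15H a b n u β) = (((1/(4*π^2*a*b)) *
     ((∫ β in (-d)..d, s15T u β) - (∫ β in (-d)..d, s15T (u-a*n) β) - (∫ β in (-d)..d, s15T (u-b*n) β)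
      + (∫ β in (-d)..d, s15T (u-(a+b)*n) β)) : ℝ) : ℂ) := by
    rw [← two_mul] at e2
    have e4 : ∀ x y : ℂ, 2 * x = y → x = (1/2) * y := by
      intro x y h; rw [← h]; ring
    rw [e4 _ _ e2]
    push_cast
    ring
  rw [e3, ← Complex.ofReal_sub, Complex.norm_real, Real.norm_eq_abs]
  generalize (∫ β in (-d)..d, s15T u β) = I1 at *
  generalize (∫ β in (-d)..d, s15T (u-a*n) β) = I2 at *
  generalize (∫ β in (-d)..d, s15T (u-b*n) β) = I3 at *
  generalize (∫ β in (-d)..d, s15T (u-(a+b)*n) β) = I4 at *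
  unfold s15h
  rw [show 1/(4*π^2*a*b) * (I1 - I2 - I3 + I4) - 1/(2*a*b) * (|u| - |u-a*n| - |u-b*n| + |u-(a+b)*n|)
    = 1/(4*π^2*(a*b)) * ((I1 - 2*π^2*|u|) - (I2 - 2*π^2*|u-a*n|) - (I3 - 2*π^2*|u-b*n|) + (I4 - 2*π^2*|u-(a+b)*n|)) by
      have := Real.pi_ne_zero
      field_simp; ring]
  rw [abs_mul, show 4/(π^2*|a*b| * d) = |1/(4*π^2*(a*b))| * (4 * (4/d)) by
    have : |a*b| ≠ 0 := by simp [ha, hb]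
    rw [abs_div, abs_mul (4*π^2), abs_of_pos (show 0 < 4*π^2 by positivity), abs_one]
    field_simp]
  gcongr
  rw [abs_le] at *
  constructor <;> linarith [t1.1, t1.2, t2.1, t2.2, t3.1, t3.2, t4.1, t4.2]

lemma s15_outer (a b n d M c : ℝ) (k : ℕ) (ha : a ≠ 0) (hb : b ≠ 0) (hd : 0 < d) (hM : 0 ≤ M) :
    ‖(∫ β in (-d)..d,
      (∫ y in (0:ℝ)..n, Complex.exp (-2 * π * Complex.I * a * y * β)) *
      (∫ y in (0:ℝ)..n, Complex.exp (-2 * π * Complex.I * b * y * β)) *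
      (∫ x in (0:ℝ)..M, Complex.exp (2 * π * Complex.I * c * x^k * β)))
      - ((∫ x in (0:ℝ)..M, s15h a b n (c * x^k) : ℝ) : ℂ)‖ ≤ 4/(π^2*|a*b| * d) * M := by
  have hc2 : Continuous (Function.uncurry fun (β x : ℝ) => s15H a b n (c*x^k) β) := by
    unfold s15H Function.uncurry
    exact (((s15_cont a n).comp continuous_fst).mul ((s15_cont b n).comp continuous_fst)).mul (by fun_prop)
  have hc3 : Continuous (Function.uncurry fun (x β : ℝ) => s15H a b n (c*x^k) β) := by
    unfold s15H Function.uncurry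
    exact (((s15_cont a n).comp continuous_snd).mul ((s15_cont b n).comp continuous_snd)).mul (by fun_prop)
  have hh : Continuous (fun x : ℝ => s15h a b n (c * x^k)) := by unfold s15h; fun_prop
  have e : (∫ β in (-d)..d,
      (∫ y in (0:ℝ)..n, Complex.exp (-2 * π * Complex.I * a * y * β)) *
      (∫ y in (0:ℝ)..n, Complex.exp (-2 * π * Complex.I * b * y * β)) *
      (∫ x in (0:ℝ)..M, Complex.exp (2 * π * Complex.I * c * x^k * β))) =
      ∫ x in (0:ℝ)..M, ∫ β in (-d)..d, s15H a b n (c*x^k) β := by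
    rw [← intervalIntegral_intervalIntegral_swap]
    · apply intervalIntegral.integral_congr
      intro β _
      simp only [s15H]
      rw [intervalIntegral.integral_const_mul]
      congr 1
      apply intervalIntegral.integral_congr
      intro x _
      simp only
      congr 1
      push_cast; ring
    · exact (hc2.continuousOn.integrableOn_compact (isCompact_uIcc.prod isCompact_uIcc)).mono_set
        (Set.prod_mono Set.uIoc_subset_uIcc Set.uIoc_subset_uIcc)
  rw [e, ← intervalIntegral.integral_ofReal, ← intervalIntegral.integral_sub]
  · have := intervalIntegral.norm_integral_le_of_norm_le_const (a := 0) (b := M)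
      (f := fun x : ℝ => (∫ β in (-d)..d, s15H a b n (c*x^k) β) - ((s15h a b n (c*x^k) : ℝ) : ℂ))
      (fun x _ => s15_inner a b n (c*x^k) d ha hb hd)
    rwa [sub_zero, abs_of_nonneg hM] at this
  · apply Continuous.intervalIntegrable
    apply intervalIntegral.continuous_parametric_intervalIntegral_of_continuous (s := fun _ => d)
      (f := fun x β => s15H a b n (c*x^k) β)
    · exact hc3
    · fun_prop
  · apply Continuous.intervalIntegrable
    fun_prop

lemma s15_psi0 (c M v : ℝ) (k : ℕ) (hk : 1 ≤ k) (hc : 0 < c) (hM : 0 ≤ M) (hv : 0 ≤ v) (hvM : v ≤ c * M^k) :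
    ∫ x in (0:ℝ)..M, max (v - c * x^k) 0 = v * (v/c)^((1:ℝ)/k) * ((k:ℝ)/(k+1)) := by
  set r := (v/c)^((1:ℝ)/k) with hr
  have hk0 : k ≠ 0 := by omega
  have hr0 : 0 ≤ r := by positivity
  have hrk : r^k = v/c := by
    rw [hr, one_div, Real.rpow_inv_natCast_pow (by positivity) hk0]
  have hrM : r ≤ M := by
    apply le_of_pow_le_pow_left₀ hk0 hM
    rw [hrk, div_le_iff₀ hc]; linarith
  have hcr : c * r^k = v := by rw [hrk]; field_simp
  have hcont : Continuous (fun x : ℝ => max (v - c * x^k) 0) := by fun_prop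
  rw [← intervalIntegral.integral_add_adjacent_intervals (b := r) (hcont.intervalIntegrable _ _)
    (hcont.intervalIntegrable _ _)]
  have e1 : ∫ x in (0:ℝ)..r, max (v - c * x^k) 0 = ∫ x in (0:ℝ)..r, (v - c * x^k) := by
    apply intervalIntegral.integral_congr
    intro x hx
    rw [Set.uIcc_of_le hr0] at hx
    have : x^k ≤ r^k := pow_le_pow_left₀ hx.1 hx.2 k
    exact max_eq_left (by nlinarith)
  have e2 : ∫ x in r..M, max (v - c * x^k) 0 = ∫ x in r..M, (0:ℝ) := by
    apply intervalIntegral.integral_congr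
    intro x hx
    rw [Set.uIcc_of_le hrM] at hx
    have : r^k ≤ x^k := pow_le_pow_left₀ hr0 hx.1 k
    exact max_eq_right (by nlinarith)
  rw [e1, e2, intervalIntegral.integral_sub (by simp) (Continuous.intervalIntegrable (by fun_prop) _ _),
    intervalIntegral.integral_const_mul, integral_pow]
  simp only [intervalIntegral.integral_const, smul_eq_mul]
  have : c * ((r^(k+1) - 0^(k+1))/((k:ℝ)+1)) = v * r / (k+1) := by
    rw [zero_pow (by omega), pow_succ, ← hcr]; ring
  rw [this]
  have : (k:ℝ)+1 ≠ 0 := by positivity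
  field_simp; ring

lemma s15_psi (c M v : ℝ) (k : ℕ) (hk : 1 ≤ k) (hc : 0 < c) (hM : 0 ≤ M) (hvM : v ≤ c * M^k) :
    ∫ x in (0:ℝ)..M, max (v - c * x^k) 0 = max v 0 * (max v 0/c)^((1:ℝ)/k) * ((k:ℝ)/(k+1)) := by
  rw [← s15_psi0 c M (max v 0) k hk hc hM (le_max_right _ _) (max_le hvM (by positivity))]
  apply intervalIntegral.integral_congr
  intro x hx
  rw [Set.uIcc_of_le hM] at hx
  have : 0 ≤ c * x^k := mul_nonneg hc.le (pow_nonneg hx.1 k)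
  simp only
  rcases le_total v 0 with h | h
  · rw [max_eq_right h, max_eq_right (by linarith), max_eq_right (by linarith)]
  · rw [max_eq_left h]

lemma s15_psi' (c M a n : ℝ) (k : ℕ) (hk : 1 ≤ k) (hc : 0 < c) (hM : 0 ≤ M) (hn : 0 < n) (hvM : a * n ≤ c * M^k) :
    ∫ x in (0:ℝ)..M, max (a * n - c * x^k) 0 = (max a 0 * (max a 0)^((1:ℝ)/k)) *
      (c^(-(1:ℝ)/k) * ((k:ℝ)/(k+1)) * n^(((k:ℝ)+1)/k)) := by
  have hk0 : (k:ℝ) ≠ 0 := by norm_cast; omega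
  rw [s15_psi c M _ k hk hc hM hvM]
  have : max (a*n) 0 = max a 0 * n := by rw [max_mul_of_nonneg _ _ hn.le, zero_mul]
  have h0 : 0 ≤ max a 0 := le_max_right _ _
  rw [this, Real.div_rpow (by positivity) hc.le, Real.mul_rpow h0 hn.le, neg_div, Real.rpow_neg hc.le,
    show ((k:ℝ)+1)/k = 1 + 1/k by field_simp, Real.rpow_add hn, Real.rpow_one]
  ring

lemma s15_abs (w : ℝ) : |w| = 2 * max (-w) 0 + w := by
  rcases le_total w 0 with h | h
  · rw [abs_of_nonpos h, max_eq_left (by linarith)]; ring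
  · rw [abs_of_nonneg h, max_eq_right (by linarith)]; ring

lemma s15_h_eq (a b n u : ℝ) : s15h a b n u = 1/(a*b) *
    (max (0*n-u) 0 - max (a*n-u) 0 - max (b*n-u) 0 + max ((a+b)*n-u) 0) := by
  unfold s15h
  rw [s15_abs u, s15_abs (u-a*n), s15_abs (u-b*n), s15_abs (u-(a+b)*n)]
  simp only [neg_sub, zero_mul, zero_sub]
  rw [show 1/(2*a*b) = 1/(a*b) * (1/2) by rw [mul_assoc, one_div_mul_one_div, mul_comm (2:ℝ)]]
  ring

lemma s15_main (c M a b n : ℝ) (k : ℕ) (hk : 1 ≤ k) (hc : 0 < c) (hM : 0 ≤ M) (hn : 0 < n)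
    (h1 : a * n ≤ c * M^k) (h2 : b * n ≤ c * M^k) (h3 : (a+b) * n ≤ c * M^k) :
    ∫ x in (0:ℝ)..M, s15h a b n (c*x^k) = 1/(a*b) *
      (max (a+b) 0 * (max (a+b) 0)^((1:ℝ)/k) - max a 0 * (max a 0)^((1:ℝ)/k)
        - max b 0 * (max b 0)^((1:ℝ)/k)) *
      (c^(-(1:ℝ)/k) * ((k:ℝ)/(k+1)) * n^(((k:ℝ)+1)/k)) := by
  simp only [s15_h_eq]
  have hi : ∀ v : ℝ, IntervalIntegrable (fun x : ℝ => max (v*n - c*x^k) 0) volume 0 M := fun v =>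
    Continuous.intervalIntegrable (by fun_prop) _ _
  rw [intervalIntegral.integral_const_mul,
    intervalIntegral.integral_add (((hi _).sub (hi _)).sub (hi _)) (hi _),
    intervalIntegral.integral_sub ((hi _).sub (hi _)) (hi _),
    intervalIntegral.integral_sub (hi _) (hi _),
    s15_psi' c M _ n k hk hc hM hn h1, s15_psi' c M _ n k hk hc hM hn h2,
    s15_psi' c M _ n k hk hc hM hn h3, s15_psi' c M 0 n k hk hc hM hn (by rw [zero_mul]; positivity)]
  simp only [max_self, zero_mul]
  ring

lemma s15_Ck (k : ℕ) (hk : 1 ≤ k) (a₁ a₂ : ℤ) (ha₁ : 0 < a₁) (ha₂ : a₂ ≠ 0) :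
    Ck k a₁ a₂ = 1/((a₁:ℝ)*a₂) *
      (max ((a₁:ℝ)+a₂) 0 * (max ((a₁:ℝ)+a₂) 0)^((1:ℝ)/k) - max (a₁:ℝ) 0 * (max (a₁:ℝ) 0)^((1:ℝ)/k)
        - max (a₂:ℝ) 0 * (max (a₂:ℝ) 0)^((1:ℝ)/k)) := by
  have h1 : (0:ℝ) < a₁ := by exact_mod_cast ha₁
  have h2 : (a₂:ℝ) ≠ 0 := by exact_mod_cast ha₂
  unfold Ck
  rw [max_eq_left h1.le]
  split_ifs with h h'
  · have h3 : (0:ℝ) < a₂ := by exact_mod_cast h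
    rw [max_eq_left h3.le, max_eq_left (by linarith)]
    field_simp; ring
  · have h3 : (a₂:ℝ) ≤ 0 := by exact_mod_cast (not_lt.1 h)
    have h4 : -(a₁:ℝ) ≤ a₂ := by exact_mod_cast h'
    rw [max_eq_right h3, max_eq_left (by linarith)]
    field_simp; ring
  · have h3 : (a₂:ℝ) ≤ 0 := by exact_mod_cast (not_lt.1 h)
    have h4 : (a₂:ℝ) < -(a₁:ℝ) := by exact_mod_cast (not_le.1 h')
    rw [max_eq_right h3, max_eq_right (by linarith)]
    field_simp; ring

theorem stmt15 (k : ℕ) (hk : 1 ≤ k) (c : ℝ) (hc : 0 < c)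
    (a₁ a₂ : ℤ) (ha₁ : 0 < a₁) (ha₂ : a₂ ≠ 0) (B : ℝ) (hB : 0 < B) :
    (fun N : ℕ =>
        (∫ β in Set.Ioo (-(Real.log N ^ B / N)) (Real.log N ^ B / N),
          (∫ y in (0:ℝ)..(N : ℝ), Complex.exp (-2 * Real.pi * Complex.I * a₁ * y * β)) *
          (∫ z in (0:ℝ)..(N : ℝ), Complex.exp (-2 * Real.pi * Complex.I * a₂ * z * β)) *
          (∫ x in (0:ℝ)..((max (a₁ : ℝ) ((a₁ : ℝ) + (a₂ : ℝ)) * N / c) ^ ((1 : ℝ) / k)),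
            Complex.exp (2 * Real.pi * Complex.I * c * x ^ k * β)))
        - ((Ck k a₁ a₂ * c ^ (-(1 : ℝ) / k) * ((k : ℝ) / (k + 1)) *
            (N : ℝ) ^ (((k : ℝ) + 1) / k) : ℝ) : ℂ))
      =O[atTop]
    (fun N : ℕ => (N : ℝ) ^ (((k : ℝ) + 1) / k) / Real.log N ^ B) := by
  have h1 : (0:ℝ) < a₁ := by exact_mod_cast ha₁
  have h2 : (a₂:ℝ) ≠ 0 := by exact_mod_cast ha₂
  have hk0 : k ≠ 0 := by omega
  have hkr : (k:ℝ) ≠ 0 := by exact_mod_cast hk0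
  set m := max (a₁ : ℝ) ((a₁ : ℝ) + (a₂ : ℝ)) with hm
  have hma : (a₁:ℝ) ≤ m := le_max_left _ _
  have hmb : (a₁:ℝ) + a₂ ≤ m := le_max_right _ _
  have hm0 : 0 < m := h1.trans_le hma
  apply IsBigO.of_bound (4/(π^2*|(a₁:ℝ)*a₂|) * (m/c)^((1:ℝ)/k))
  filter_upwards [eventually_ge_atTop 2] with N hN
  have hN' : (2:ℝ) ≤ N := by exact_mod_cast hN
  have hN0 : (0:ℝ) < N := by linarith
  have hL : 0 < Real.log N ^ B := Real.rpow_pos_of_pos (Real.log_pos (by linarith)) _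
  set L := Real.log N ^ B with hLd
  have hd : 0 < L / N := by positivity
  set M := (m * N / c) ^ ((1 : ℝ) / k) with hMd
  have hM : 0 ≤ M := by positivity
  have hMk : c * M^k = m * N := by
    rw [hMd, one_div, Real.rpow_inv_natCast_pow (by positivity) hk0]; field_simp
  have key := s15_outer a₁ a₂ N (L/N) M c k h1.ne' h2 hd hM
  rw [s15_main c M a₁ a₂ N k hk hc hM hN0 (by rw [hMk]; gcongr) (by rw [hMk]; gcongr; linarith)
    (by rw [hMk]; gcongr), ← s15_Ck k hk a₁ a₂ ha₁ ha₂] at key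
  rw [← integral_Ioc_eq_integral_Ioo, ← intervalIntegral.integral_of_le (by linarith)]
  simp only [Complex.ofReal_intCast, Complex.ofReal_natCast] at key ⊢
  rw [show Ck k a₁ a₂ * c ^ (-(1 : ℝ) / k) * ((k : ℝ) / (k + 1)) * (N : ℝ) ^ (((k : ℝ) + 1) / k)
    = Ck k a₁ a₂ * (c ^ (-(1 : ℝ) / k) * ((k : ℝ) / (k + 1)) * (N : ℝ) ^ (((k : ℝ) + 1) / k)) by ring]
  refine key.trans (le_of_eq ?_)
  rw [Real.norm_of_nonneg (by positivity), hMd, show m*N/c = m/c*N by ring,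
    Real.mul_rpow (by positivity) hN0.le,
    show ((k:ℝ)+1)/k = 1 + 1/k by field_simp, Real.rpow_add hN0, Real.rpow_one]
  have : |(a₁:ℝ)*a₂| ≠ 0 := by simp [h1.ne', h2]
  field_simp
end
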